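/- Let P₁, Q₁ be probability measures on a measurable space X₁ and P₂, Q₂ be probability measures on a measurable space X₂, with P₁ absolutely continuous with respect to Q₁ and P₂ absolutely continuous with respect to Q₂, and let α > 1. Then the product measure P₁ ⊗ P₂ is absolutely continuous with respect to Q₁ ⊗ Q₂, and ∫ (d(P₁ ⊗ P₂)/d(Q₁ ⊗ Q₂))^α d(Q₁ ⊗ Q₂) = (∫ (dP₁/dQ₁)^α dQ₁) · (∫ (dP₂/dQ₂)^α dQ₂). -/

import Mathlib

open MeasureTheory

theorem renyi_composition (X₁ X₂ : Type*) [MeasurableSpace X₁] [MeasurableSpace X₂]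
    (P₁ Q₁ : Measure X₁) (P₂ Q₂ : Measure X₂)
    [IsProbabilityMeasure P₁] [IsProbabilityMeasure Q₁]
    [IsProbabilityMeasure P₂] [IsProbabilityMeasure Q₂]
    (h₁ : P₁ ≪ Q₁) (h₂ : P₂ ≪ Q₂) (α : ℝ) (hα : 1 < α) :
    P₁.prod P₂ ≪ Q₁.prod Q₂ ∧
    (∫ x, ((P₁.prod P₂).rnDeriv (Q₁.prod Q₂) x).toReal ^ α ∂(Q₁.prod Q₂)) =
      (∫ x, (P₁.rnDeriv Q₁ x).toReal ^ α ∂Q₁) *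
        ∫ x, (P₂.rnDeriv Q₂ x).toReal ^ α ∂Q₂ := by
  refine ⟨h₁.prod h₂, ?_⟩
  have hm₁ := Measure.measurable_rnDeriv P₁ Q₁
  have hm₂ := Measure.measurable_rnDeriv P₂ Q₂
  have hprod : P₁.prod P₂ = (Q₁.prod Q₂).withDensity
      (fun z => P₁.rnDeriv Q₁ z.1 * P₂.rnDeriv Q₂ z.2) := by
    rw [← prod_withDensity hm₁ hm₂, Measure.withDensity_rnDeriv_eq _ _ h₁,
      Measure.withDensity_rnDeriv_eq _ _ h₂]
  have hae : (P₁.prod P₂).rnDeriv (Q₁.prod Q₂) =ᵐ[Q₁.prod Q₂]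
      (fun z => P₁.rnDeriv Q₁ z.1 * P₂.rnDeriv Q₂ z.2) := by
    rw [hprod]
    exact Measure.rnDeriv_withDensity _
      ((hm₁.comp measurable_fst).mul (hm₂.comp measurable_snd))
  rw [← integral_prod_mul]
  refine integral_congr_ae ?_
  filter_upwards [hae] with z hz
  rw [hz, ENNReal.toReal_mul, Real.mul_rpow ENNReal.toReal_nonneg ENNReal.toReal_nonneg]
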